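/- arXiv:2510.12013 — 2 statements merged into one kernel-verified Lean document; each statement's English description precedes it below -/
import Mathlib

section
/- Let q ≥ 2, s ≥ 2 an even integer, and let x, y be d-dimensional random vectors with E|x|_s^q < ∞ and E|y|_s^q < ∞. If E[y | x] = 0 almost surely, then ‖|x + y|_s‖_q² ≤ ‖|x|_s‖_q² + (max{q, s} − 1) ‖|y|_s‖_q², where ‖X‖_q = (E|X|^q)^{1/q}. -/
open Finset Real MeasureTheory

/-- The `ℓ^s` norm for a natural exponent `s`. -/
noncomputable def lnorm (s : ℕ) {d : ℕ} (x : Fin d → ℝ) : ℝ :=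
  (∑ i, |x i| ^ s) ^ (1 / (s : ℝ))

lemma sub_rpow_le_mul_add_rpow {n t : ℝ} (hn : 1 ≤ n) (ht : t ∈ Set.Icc (0 : ℝ) 1) :
    (1 + t) ^ n - (1 - t) ^ n ≤ n * t * ((1 + t) ^ n + (1 - t) ^ n) := by
  have hmono : MonotoneOn
      (fun t : ℝ => n * t * ((1 + t) ^ n + (1 - t) ^ n) - ((1 + t) ^ n - (1 - t) ^ n))
      (Set.Icc 0 1) := by
    have hder : ∀ t : ℝ, HasDerivAt
        (fun t : ℝ => n * t * ((1 + t) ^ n + (1 - t) ^ n) - ((1 + t) ^ n - (1 - t) ^ n))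
        (n * 1 * ((1 + t) ^ n + (1 - t) ^ n)
          + n * t * (1 * n * (1 + t) ^ (n - 1) + -1 * n * (1 - t) ^ (n - 1))
          - (1 * n * (1 + t) ^ (n - 1) - -1 * n * (1 - t) ^ (n - 1))) t := by
      intro t
      have h1 := ((hasDerivAt_id' t).const_add 1).rpow_const (p := n) (Or.inr hn)
      have h2 := ((hasDerivAt_id' t).const_sub 1).rpow_const (p := n) (Or.inr hn)
      exact (((hasDerivAt_id' t).const_mul n).mul (h1.add h2)).sub (h1.sub h2)
    refine monotoneOn_of_hasDerivWithinAt_nonneg (convex_Icc 0 1)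
      (fun t _ => (hder t).continuousAt.continuousWithinAt)
      (fun t _ => (hder t).hasDerivWithinAt) fun t ht => ?_
    rw [interior_Icc] at ht
    obtain ⟨h0, h1⟩ := ht
    have e1 : (1 + t) ^ n = (1 + t) ^ (n - 1) * (1 + t) := by
      rw [← rpow_add_one (by linarith), sub_add_cancel]
    have e2 : (1 - t) ^ n = (1 - t) ^ (n - 1) * (1 - t) := by
      rw [← rpow_add_one (by linarith), sub_add_cancel]
    have hle : (1 - t) ^ (n - 1) ≤ (1 + t) ^ (n - 1) :=
      rpow_le_rpow (by linarith) (by linarith) (by linarith)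
    rw [e1, e2]
    have : 0 ≤ n * t * (n + 1) * ((1 + t) ^ (n - 1) - (1 - t) ^ (n - 1)) :=
      mul_nonneg (by positivity) (by linarith)
    linarith
  have h := hmono (Set.left_mem_Icc.2 zero_le_one) ht ht.1
  simp at h
  linarith

lemma one_add_rpow_add_one_sub_rpow_le {r t : ℝ} (hr : 2 ≤ r) (ht : t ∈ Set.Icc (0 : ℝ) 1) :
    (1 + t) ^ r + (1 - t) ^ r ≤ 2 * (1 + (r - 1) * t ^ 2) ^ (r / 2) := by
  have hpos : ∀ t : ℝ, 0 < 1 + (r - 1) * t ^ 2 := fun t => by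
    have : 0 ≤ (r - 1) * t ^ 2 := mul_nonneg (by linarith) (sq_nonneg t)
    linarith
  have hanti : AntitoneOn
      (fun t : ℝ => ((1 + t) ^ r + (1 - t) ^ r) * (1 + (r - 1) * t ^ 2) ^ (-(r / 2)))
      (Set.Icc 0 1) := by
    have hder : ∀ t : ℝ, HasDerivAt
        (fun t : ℝ => ((1 + t) ^ r + (1 - t) ^ r) * (1 + (r - 1) * t ^ 2) ^ (-(r / 2)))
        ((1 * r * (1 + t) ^ (r - 1) + -1 * r * (1 - t) ^ (r - 1))
            * (1 + (r - 1) * t ^ 2) ^ (-(r / 2))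
          + ((1 + t) ^ r + (1 - t) ^ r) * ((r - 1) * (2 * t) * (-(r / 2))
            * (1 + (r - 1) * t ^ 2) ^ (-(r / 2) - 1))) t := by
      intro t
      have h1 := ((hasDerivAt_id' t).const_add 1).rpow_const (p := r) (Or.inr (by linarith))
      have h2 := ((hasDerivAt_id' t).const_sub 1).rpow_const (p := r) (Or.inr (by linarith))
      have h3 : HasDerivAt (fun t : ℝ => 1 + (r - 1) * t ^ 2) ((r - 1) * (2 * t)) t := by
        simpa using ((hasDerivAt_pow 2 t).const_mul (r - 1)).const_add 1
      exact (h1.add h2).mul (h3.rpow_const (Or.inl (hpos t).ne'))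
    refine antitoneOn_of_hasDerivWithinAt_nonpos (convex_Icc 0 1)
      (fun t _ => (hder t).continuousAt.continuousWithinAt)
      (fun t _ => (hder t).hasDerivWithinAt) fun t ht => ?_
    have hD := sub_rpow_le_mul_add_rpow (n := r - 1) (by linarith) (interior_subset ht)
    rw [interior_Icc] at ht
    obtain ⟨h0, h1⟩ := ht
    have e1 : (1 + t) ^ r = (1 + t) ^ (r - 1) * (1 + t) := by
      rw [← rpow_add_one (by linarith), sub_add_cancel]
    have e2 : (1 - t) ^ r = (1 - t) ^ (r - 1) * (1 - t) := by
      rw [← rpow_add_one (by linarith), sub_add_cancel]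
    have e3 : (1 + (r - 1) * t ^ 2) ^ (-(r / 2))
        = (1 + (r - 1) * t ^ 2) ^ (-(r / 2) - 1) * (1 + (r - 1) * t ^ 2) := by
      rw [← rpow_add_one (hpos t).ne', sub_add_cancel]
    rw [e1, e2, e3]
    have : 0 ≤ r * (1 + (r - 1) * t ^ 2) ^ (-(r / 2) - 1)
        * ((r - 1) * t * ((1 + t) ^ (r - 1) + (1 - t) ^ (r - 1))
          - ((1 + t) ^ (r - 1) - (1 - t) ^ (r - 1))) :=
      mul_nonneg (mul_nonneg (by linarith) (rpow_nonneg (hpos t).le _)) (by linarith)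
    linarith
  have h := hanti (Set.left_mem_Icc.2 zero_le_one) ht ht.1
  simp only [add_zero, sub_zero, one_rpow, ne_eq, OfNat.ofNat_ne_zero, not_false_eq_true,
    zero_pow, mul_zero, mul_one] at h
  rw [rpow_neg (hpos t).le, ← div_eq_mul_inv, div_le_iff₀ (rpow_pos_of_pos (hpos t) _)] at h
  linarith

lemma add_rpow_add_sub_rpow_le {r a b : ℝ} (hr : 2 ≤ r) (hb : 0 ≤ b) (hba : b ≤ a) :
    (a + b) ^ r + (a - b) ^ r ≤ 2 * (a ^ 2 + (r - 1) * b ^ 2) ^ (r / 2) := by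
  rcases (hb.trans hba).eq_or_lt with rfl | ha
  · have : b = 0 := le_antisymm hba hb
    subst this
    simp [zero_rpow (show r ≠ 0 by linarith), zero_rpow (show r / 2 ≠ 0 by linarith)]
  have ht1 : b / a ≤ 1 := (div_le_one ha).2 hba
  have h := one_add_rpow_add_one_sub_rpow_le hr ⟨div_nonneg hb ha.le, ht1⟩
  have hsq : (0 : ℝ) ≤ 1 + (r - 1) * (b / a) ^ 2 := by
    have : 0 ≤ (r - 1) * (b / a) ^ 2 := mul_nonneg (by linarith) (sq_nonneg _)
    linarith
  have e1 : a + b = a * (1 + b / a) := by field_simp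
  have e2 : a - b = a * (1 - b / a) := by field_simp
  have e3 : a ^ 2 + (r - 1) * b ^ 2 = a ^ 2 * (1 + (r - 1) * (b / a) ^ 2) := by field_simp
  have e4 : (a ^ 2) ^ (r / 2) = a ^ r := by
    rw [← rpow_natCast, ← rpow_mul ha.le]
    congr 1
    push_cast
    ring
  have hdiv : 0 ≤ b / a := div_nonneg hb ha.le
  rw [e1, e2, e3, mul_rpow ha.le (by linarith), mul_rpow ha.le (by linarith),
    mul_rpow (sq_nonneg a) hsq, e4]
  have := mul_le_mul_of_nonneg_left h (rpow_nonneg ha.le r)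
  linarith

/-- The two-point inequality for the real line with the sharp constant `r - 1`. -/
lemma abs_add_rpow_add_abs_sub_rpow_le {r : ℝ} (hr : 2 ≤ r) (a b : ℝ) :
    |a + b| ^ r + |a - b| ^ r ≤ 2 * (a ^ 2 + (r - 1) * b ^ 2) ^ (r / 2) := by
  have hsymm : |a + b| ^ r + |a - b| ^ r = (|a| + |b|) ^ r + |(|a| - |b|)| ^ r := by
    rcases le_total 0 a with ha | ha <;> rcases le_total 0 b with hb | hb
    · rw [abs_of_nonneg ha, abs_of_nonneg hb, abs_of_nonneg (add_nonneg ha hb)]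
    · rw [abs_of_nonneg ha, abs_of_nonpos hb, sub_neg_eq_add, ← sub_eq_add_neg,
        abs_of_nonneg (show 0 ≤ a - b by linarith), add_comm]
    · rw [abs_of_nonpos ha, abs_of_nonneg hb, show -a - b = -(a + b) by ring, abs_neg,
        abs_of_nonpos (show a - b ≤ 0 by linarith), add_comm, show -(a - b) = -a + b by ring]
    · rw [abs_of_nonpos ha, abs_of_nonpos hb, abs_of_nonpos (add_nonpos ha hb),
        show -a - -b = -(a - b) by ring, abs_neg, show -(a + b) = -a + -b by ring]
  rw [hsymm, ← sq_abs a, ← sq_abs b]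
  rcases le_total |b| |a| with h | h
  · rw [abs_of_nonneg (sub_nonneg.2 h)]
    exact add_rpow_add_sub_rpow_le hr (abs_nonneg b) h
  · rw [abs_sub_comm, abs_of_nonneg (sub_nonneg.2 h), add_comm |a|]
    refine (add_rpow_add_sub_rpow_le hr (abs_nonneg a) h).trans ?_
    gcongr ?_ * ?_ ^ ?_
    · exact add_nonneg (sq_nonneg _) (mul_nonneg (by linarith) (sq_nonneg _))
    · have : |a| ^ 2 ≤ |b| ^ 2 := by gcongr
      nlinarith

lemma le_add_of_second_difference_le {g : ℝ → ℝ} {C : ℝ}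
    (hsmooth : ∀ t h, g (t + h) + g (t - h) ≤ 2 * g t + 2 * C * h ^ 2)
    (hmin : ∀ t, g 0 ≤ g t) : g 1 ≤ g 0 + C := by
  have hstep : ∀ (h : ℝ) (k : ℕ), g ((k + 1) * h) - g (k * h) ≤ 2 * C * h ^ 2 * (k + 1) := by
    intro h k
    induction k with
    | zero =>
      have h1 := hsmooth 0 h
      have h2 := hmin (0 - h)
      simp only [Nat.cast_zero, zero_add, one_mul, zero_mul, mul_one] at h1 ⊢
      linarith
    | succ k ih =>
      have h1 := hsmooth ((k + 1) * h) h
      rw [show ((k : ℝ) + 1) * h - h = k * h by ring,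
        show ((k : ℝ) + 1) * h + h = (k + 1 + 1) * h by ring] at h1
      push_cast
      linarith
  have hsum : ∀ (h : ℝ) (k : ℕ), g (k * h) - g 0 ≤ C * h ^ 2 * (k * (k + 1)) := by
    intro h k
    induction k with
    | zero => simp
    | succ k ih =>
      have := hstep h k
      push_cast
      linarith
  have hlim : Filter.Tendsto (fun n : ℕ => g 0 + C * (1 + 1 / ((n : ℝ) + 1))) Filter.atTop
      (nhds (g 0 + C)) := by
    simpa using ((tendsto_one_div_add_atTop_nhds_zero_nat (𝕜 := ℝ)).const_add 1).const_mul C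
      |>.const_add (g 0)
  refine ge_of_tendsto' hlim fun n => ?_
  have h := hsum (1 / ((n : ℝ) + 1)) (n + 1)
  have hn : ((n : ℝ) + 1) ≠ 0 := by positivity
  have e : C * (1 / ((n : ℝ) + 1)) ^ 2 * (((n + 1 : ℕ) : ℝ) * (((n + 1 : ℕ) : ℝ) + 1))
      = C * (1 + 1 / ((n : ℝ) + 1)) := by
    push_cast
    field_simp
  rw [e, Nat.cast_add_one, mul_one_div_cancel hn] at h
  linarith

lemma sq_add_sq_le_of_rpow_add_rpow_le {r α β K : ℝ} (hr : 2 ≤ r) (hα : 0 ≤ α) (hβ : 0 ≤ β)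
    (hK : 0 ≤ K) (h : α ^ r + β ^ r ≤ 2 * K ^ (r / 2)) : α ^ 2 + β ^ 2 ≤ 2 * K := by
  have hsq : ∀ x : ℝ, 0 ≤ x → (x ^ 2) ^ (r / 2) = x ^ r := fun x hx => by
    rw [← rpow_natCast, ← rpow_mul hx]
    congr 1
    push_cast
    ring
  have hconv := (convexOn_rpow (show 1 ≤ r / 2 by linarith)).2 (Set.mem_Ici.2 (sq_nonneg α))
    (Set.mem_Ici.2 (sq_nonneg β)) (show (0 : ℝ) ≤ 1 / 2 by norm_num)
    (show (0 : ℝ) ≤ 1 / 2 by norm_num) (by norm_num)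
  simp only [smul_eq_mul, hsq _ hα, hsq _ hβ] at hconv
  have := (rpow_le_rpow_iff (by positivity) hK (show 0 < r / 2 by linarith)).1
    (hconv.trans (show _ ≤ K ^ (r / 2) by linarith))
  linarith

/-- Minkowski's integral inequality for two functions. -/
lemma integral_rpow_add_integral_rpow_le {S : Type*} [MeasurableSpace S] {ν : Measure S}
    {k : ℝ} (hk : 1 ≤ k) {f g : S → ℝ} (hf : Integrable f ν) (hg : Integrable g ν)
    (hf0 : ∀ z, 0 ≤ f z) (hg0 : ∀ z, 0 ≤ g z) :
    (∫ z, f z ∂ν) ^ k + (∫ z, g z ∂ν) ^ k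
      ≤ (∫ z, (f z ^ k + g z ^ k) ^ (1 / k) ∂ν) ^ k := by
  have hk0 : 0 < k := by linarith
  set p : ENNReal := ENNReal.ofReal k with hp
  have hpk : p.toReal = k := ENNReal.toReal_ofReal hk0.le
  have : Fact (1 ≤ p) := ⟨ENNReal.one_le_ofReal.2 hk⟩
  let φ : S → WithLp p (ℝ × ℝ) := fun z => WithLp.toLp p (f z, g z)
  have hφ : Integrable φ ν :=
    (WithLp.prodContinuousLinearEquiv p ℝ ℝ ℝ).symm.toContinuousLinearMap.integrable_comp
      (hf.prodMk hg)
  have h1 : (∫ z, φ z ∂ν).fst = ∫ z, f z ∂ν :=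
    ((WithLp.fstL p ℝ ℝ ℝ).integral_comp_comm hφ).symm
  have h2 : (∫ z, φ z ∂ν).snd = ∫ z, g z ∂ν :=
    ((WithLp.sndL p ℝ ℝ ℝ).integral_comp_comm hφ).symm
  have h := norm_integral_le_integral_norm (μ := ν) φ
  have hn : ∀ z, ‖φ z‖ = (f z ^ k + g z ^ k) ^ (1 / k) := fun z => by
    rw [WithLp.prod_norm_eq_add (by rwa [hpk]), hpk]
    simp [φ, abs_of_nonneg (hf0 z), abs_of_nonneg (hg0 z)]
  have hF := integral_nonneg (μ := ν) (f := f) hf0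
  have hG := integral_nonneg (μ := ν) (f := g) hg0
  simp only [hn] at h
  rw [WithLp.prod_norm_eq_add (by rwa [hpk]), hpk, h1, h2, norm_of_nonneg hF,
    norm_of_nonneg hG] at h
  have hsum : 0 ≤ (∫ z, f z ∂ν) ^ k + (∫ z, g z ∂ν) ^ k := by positivity
  have := rpow_le_rpow (rpow_nonneg hsum _) h hk0.le
  rwa [← rpow_mul hsum, one_div_mul_cancel hk0.ne', rpow_one] at this

lemma lpNorm_ofReal_eq {S E : Type*} [MeasurableSpace S] [NormedAddCommGroup E]
    {ν : Measure S} {p : ℝ} (hp : 0 < p) {f : S → E} (hf : AEStronglyMeasurable f ν) :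
    lpNorm f (ENNReal.ofReal p) ν = (∫ z, ‖f z‖ ^ p ∂ν) ^ (1 / p) := by
  rw [lpNorm_eq_integral_norm_rpow_toReal (ENNReal.ofReal_pos.2 hp).ne' ENNReal.ofReal_ne_top hf,
    ENNReal.toReal_ofReal hp.le, one_div]

lemma integrable_norm_rpow_of_memLp {S E : Type*} [MeasurableSpace S] [NormedAddCommGroup E]
    {ν : Measure S} {p : ℝ} (hp : 0 < p) {f : S → E} (hf : MemLp f (ENNReal.ofReal p) ν) :
    Integrable (fun z => ‖f z‖ ^ p) ν := by
  simpa [ENNReal.toReal_ofReal hp.le] using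
    hf.integrable_norm_rpow (ENNReal.ofReal_pos.2 hp).ne' ENNReal.ofReal_ne_top

/-- A two-point inequality between norms, valid pointwise, passes to `L^p` norms. -/
lemma lpNorm_rpow_add_lpNorm_rpow_le {S : Type*} [MeasurableSpace S] {ν : Measure S}
    {p r c : ℝ} (hp : 2 ≤ p) (hpr : p ≤ r) (hc : 0 ≤ c) {F G a b : S → ℝ}
    (hF : MemLp F (ENNReal.ofReal p) ν) (hG : MemLp G (ENNReal.ofReal p) ν)
    (ha : MemLp a (ENNReal.ofReal p) ν) (hb : MemLp b (ENNReal.ofReal p) ν)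
    (h : ∀ z, |F z| ^ r + |G z| ^ r ≤ 2 * (a z ^ 2 + c * b z ^ 2) ^ (r / 2)) :
    lpNorm F (ENNReal.ofReal p) ν ^ r + lpNorm G (ENNReal.ofReal p) ν ^ r
      ≤ 2 * (lpNorm a (ENNReal.ofReal p) ν ^ 2
        + c * lpNorm b (ENNReal.ofReal p) ν ^ 2) ^ (r / 2) := by
  have hp0 : 0 < p := by linarith
  have hr0 : 0 < r := by linarith
  set k := r / p with hk
  have hk1 : 1 ≤ k := (one_le_div hp0).2 hpr
  have hk0 : 0 < k := by linarith
  have hpk : p * k = r := by rw [hk]; field_simp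
  have hsq : ∀ x : ℝ, ‖x ^ 2‖ ^ (p / 2) = ‖x‖ ^ p := fun x => by
    rw [norm_pow, ← rpow_natCast, ← rpow_mul (norm_nonneg x)]
    congr 1
    push_cast
    ring
  have hmeas : ∀ u : S → ℝ, MemLp u (ENNReal.ofReal p) ν →
      AEStronglyMeasurable (fun z => u z ^ 2) ν := fun u hu => hu.1.pow 2
  have hmem : ∀ u : S → ℝ, MemLp u (ENNReal.ofReal p) ν →
      MemLp (fun z => u z ^ 2) (ENNReal.ofReal (p / 2)) ν := fun u hu => by
    rw [← integrable_norm_rpow_iff (hmeas u hu) (ENNReal.ofReal_pos.2 (by linarith)).ne'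
      ENNReal.ofReal_ne_top, ENNReal.toReal_ofReal (by linarith)]
    simpa only [hsq] using integrable_norm_rpow_of_memLp hp0 hu
  have hlp : ∀ u : S → ℝ, MemLp u (ENNReal.ofReal p) ν →
      lpNorm (fun z => u z ^ 2) (ENNReal.ofReal (p / 2)) ν
        = lpNorm u (ENNReal.ofReal p) ν ^ 2 := fun u hu => by
    rw [lpNorm_ofReal_eq (by linarith) (hmeas u hu), lpNorm_ofReal_eq hp0 hu.1]
    simp only [hsq]
    rw [← rpow_mul_natCast (integral_nonneg fun z => by positivity)]
    congr 1
    push_cast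
    field_simp
  have hpow : ∀ u : S → ℝ, MemLp u (ENNReal.ofReal p) ν →
      lpNorm u (ENNReal.ofReal p) ν ^ r = (∫ z, |u z| ^ p ∂ν) ^ k := fun u hu => by
    rw [lpNorm_ofReal_eq hp0 hu.1, ← rpow_mul (integral_nonneg fun z => by positivity)]
    congr 1
    rw [hk]
    field_simp
  set w : S → ℝ := (fun z => a z ^ 2) + c • (fun z => b z ^ 2) with hw
  have hwz : ∀ z, w z = a z ^ 2 + c * b z ^ 2 := fun z => by simp [hw]
  have hw0 : ∀ z, 0 ≤ w z := fun z => by rw [hwz]; positivity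
  have hwm : MemLp w (ENNReal.ofReal (p / 2)) ν := (hmem a ha).add ((hmem b hb).const_smul c)
  have hwint : Integrable (fun z => w z ^ (p / 2)) ν := by
    have := integrable_norm_rpow_of_memLp (by linarith) hwm
    simpa only [norm_of_nonneg (hw0 _)] using this
  have htri : lpNorm w (ENNReal.ofReal (p / 2)) ν
      ≤ lpNorm a (ENNReal.ofReal p) ν ^ 2 + c * lpNorm b (ENNReal.ofReal p) ν ^ 2 := by
    refine (lpNorm_add_le (hmem a ha) (ENNReal.one_le_ofReal.2 (by linarith))).trans ?_
    rw [lpNorm_const_smul, hlp a ha, hlp b hb, coe_nnnorm, norm_of_nonneg hc]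
  have hwpow : lpNorm w (ENNReal.ofReal (p / 2)) ν ^ (r / 2) = (∫ z, w z ^ (p / 2) ∂ν) ^ k := by
    rw [lpNorm_ofReal_eq (by linarith) hwm.1, ← rpow_mul (integral_nonneg fun z => by positivity)]
    simp only [norm_of_nonneg (hw0 _)]
    congr 1
    rw [hk]
    field_simp
  rw [hpow F hF, hpow G hG]
  refine (integral_rpow_add_integral_rpow_le hk1 (integrable_norm_rpow_of_memLp hp0 hF)
    (integrable_norm_rpow_of_memLp hp0 hG) (fun z => by positivity)
    (fun z => by positivity)).trans ?_
  calc (∫ z, ((‖F z‖ ^ p) ^ k + (‖G z‖ ^ p) ^ k) ^ (1 / k) ∂ν) ^ k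
      ≤ (∫ z, 2 ^ (1 / k) * w z ^ (p / 2) ∂ν) ^ k := by
        refine rpow_le_rpow (integral_nonneg fun z => by positivity) ?_ hk0.le
        refine integral_mono_of_nonneg (ae_of_all _ fun z => by positivity)
          (hwint.const_mul _) (ae_of_all _ fun z => ?_)
        have hz := h z
        rw [← hwz z] at hz
        simp only [← rpow_mul (norm_nonneg _), hpk]
        refine (rpow_le_rpow (by positivity) hz (by positivity)).trans_eq ?_
        rw [mul_rpow zero_le_two (rpow_nonneg (hw0 z) _), ← rpow_mul (hw0 z)]
        congr 2
        rw [hk]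
        field_simp
    _ = 2 * lpNorm w (ENNReal.ofReal (p / 2)) ν ^ (r / 2) := by
        rw [integral_const_mul, mul_rpow (by positivity)
          (integral_nonneg fun z => rpow_nonneg (hw0 z) _), ← rpow_mul zero_le_two,
          one_div_mul_cancel hk0.ne', rpow_one, hwpow]
    _ ≤ _ := by
        gcongr
        exact lpNorm_nonneg

lemma norm_add_rpow_add_norm_sub_rpow_le_piLp {d : ℕ} {s r : ℝ} (hs : 2 ≤ s) (hsr : s ≤ r)
    [Fact (1 ≤ ENNReal.ofReal s)] (u v : PiLp (ENNReal.ofReal s) fun _ : Fin d => ℝ) :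
    ‖u + v‖ ^ r + ‖u - v‖ ^ r ≤ 2 * (‖u‖ ^ 2 + (r - 1) * ‖v‖ ^ 2) ^ (r / 2) := by
  have hs0 : 0 < s := by linarith
  have hnorm : ∀ u : PiLp (ENNReal.ofReal s) fun _ : Fin d => ℝ,
      ‖u‖ = lpNorm (fun i => u i) (ENNReal.ofReal s) Measure.count := fun u => by
    rw [lpNorm_ofReal_eq hs0 (by fun_prop), integral_fintype .of_finite,
      PiLp.norm_eq_sum (by rwa [ENNReal.toReal_ofReal hs0.le]), ENNReal.toReal_ofReal hs0.le]
    simp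
  simp only [hnorm]
  refine lpNorm_rpow_add_lpNorm_rpow_le hs hsr (by linarith) .of_discrete .of_discrete
    .of_discrete .of_discrete fun i => ?_
  exact abs_add_rpow_add_abs_sub_rpow_le (hs.trans hsr) (u i) (v i)

lemma lpNorm_add_sq_add_lpNorm_sub_sq_le {S E : Type*} [MeasurableSpace S]
    [NormedAddCommGroup E] {ν : Measure S} {p r : ℝ} (hp : 2 ≤ p) (hpr : p ≤ r)
    (hE : ∀ u v : E, ‖u + v‖ ^ r + ‖u - v‖ ^ r ≤ 2 * (‖u‖ ^ 2 + (r - 1) * ‖v‖ ^ 2) ^ (r / 2))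
    {X Y : S → E} (hX : MemLp X (ENNReal.ofReal p) ν) (hY : MemLp Y (ENNReal.ofReal p) ν) :
    lpNorm (X + Y) (ENNReal.ofReal p) ν ^ 2 + lpNorm (X - Y) (ENNReal.ofReal p) ν ^ 2
      ≤ 2 * (lpNorm X (ENNReal.ofReal p) ν ^ 2
        + (r - 1) * lpNorm Y (ENNReal.ofReal p) ν ^ 2) := by
  have hc : 0 ≤ r - 1 := by linarith
  refine sq_add_sq_le_of_rpow_add_rpow_le (hp.trans hpr) lpNorm_nonneg lpNorm_nonneg
    (by positivity) ?_
  rw [← lpNorm_norm (hX.add hY).1, ← lpNorm_norm (hX.sub hY).1, ← lpNorm_norm hX.1,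
    ← lpNorm_norm hY.1]
  refine lpNorm_rpow_add_lpNorm_rpow_le hp hpr hc (hX.add hY).norm (hX.sub hY).norm
    hX.norm hY.norm fun z => ?_
  simpa using hE (X z) (Y z)

/-- Rio's inequality in a Banach space satisfying a two-point inequality. -/
lemma lpNorm_add_sq_le_of_condExp_eq_zero {Ω E : Type*} {m m₀ : MeasurableSpace Ω}
    [NormedAddCommGroup E] [NormedSpace ℝ E] [CompleteSpace E] {μ : Measure Ω}
    [IsProbabilityMeasure μ] {p r : ℝ} (hp : 2 ≤ p) (hpr : p ≤ r)
    (hE : ∀ u v : E, ‖u + v‖ ^ r + ‖u - v‖ ^ r ≤ 2 * (‖u‖ ^ 2 + (r - 1) * ‖v‖ ^ 2) ^ (r / 2))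
    (hm : m ≤ m₀) {X Y : Ω → E} (hX : MemLp X (ENNReal.ofReal p) μ)
    (hY : MemLp Y (ENNReal.ofReal p) μ) (hXm : StronglyMeasurable[m] X)
    (hcond : μ[Y | m] =ᵐ[μ] 0) :
    lpNorm (X + Y) (ENNReal.ofReal p) μ ^ 2
      ≤ lpNorm X (ENNReal.ofReal p) μ ^ 2 + (r - 1) * lpNorm Y (ENNReal.ofReal p) μ ^ 2 := by
  have hp1 : 1 ≤ ENNReal.ofReal p := ENNReal.one_le_ofReal.2 (by linarith)
  have hmem : ∀ t : ℝ, MemLp (X + t • Y) (ENNReal.ofReal p) μ := fun t =>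
    hX.add (hY.const_smul t)
  have := le_add_of_second_difference_le
    (g := fun t => lpNorm (X + t • Y) (ENNReal.ofReal p) μ ^ 2)
    (C := (r - 1) * lpNorm Y (ENNReal.ofReal p) μ ^ 2) ?_ ?_
  · simpa using this
  · intro t h
    have := lpNorm_add_sq_add_lpNorm_sub_sq_le hp hpr hE (hmem t) (hY.const_smul h)
    rw [lpNorm_const_smul, coe_nnnorm, mul_pow, norm_eq_abs, sq_abs] at this
    simp only [add_smul, sub_smul, ← add_assoc, ← add_sub_assoc]
    linarith
  · intro t
    simp only [zero_smul, add_zero]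
    gcongr
    · exact lpNorm_nonneg
    have hXi := hX.integrable hp1
    have hYi := hY.integrable hp1
    have hce : μ[X + t • Y | m] =ᵐ[μ] X := by
      filter_upwards [condExp_add hXi (hYi.smul t) m, condExp_smul t Y m (μ := μ), hcond]
        with ω h1 h2 h3
      rw [h1, Pi.add_apply, h2, condExp_of_stronglyMeasurable hm hXm hXi]
      simp [h3]
    have h := eLpNorm_condExp_le_eLpNorm (m := m) (μ := μ) (X + t • Y) hp1
    rw [eLpNorm_congr_ae hce] at h
    rw [← toReal_eLpNorm hX.1, ← toReal_eLpNorm (hmem t).1]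
    exact ENNReal.toReal_mono (hmem t).2.ne h

lemma condExp_piLp_eq_zero {Ω : Type*} {m m₀ : MeasurableSpace Ω} {μ : Measure Ω} {d : ℕ}
    {p : ENNReal} [Fact (1 ≤ p)] {Y : Ω → PiLp p fun _ : Fin d => ℝ} (hY : Integrable Y μ)
    (h : ∀ i, μ[fun ω => Y ω i | m] =ᵐ[μ] 0) : μ[Y | m] =ᵐ[μ] 0 := by
  have hcoord : ∀ i, (fun ω => (μ[Y | m]) ω i) =ᵐ[μ] μ[fun ω => Y ω i | m] := fun i =>
    (PiLp.proj (𝕜 := ℝ) p (fun _ : Fin d => ℝ) i).comp_condExp_comm hY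
  have h0 : ∀ᵐ ω ∂μ, ∀ i, (μ[Y | m]) ω i = 0 := ae_all_iff.2 fun i => (hcoord i).trans (h i)
  exact h0.mono fun ω hω => PiLp.ext hω

lemma lpNorm_add_sq_le_piLp {Ω : Type*} {m m₀ : MeasurableSpace Ω} {μ : Measure Ω}
    [IsProbabilityMeasure μ] {d : ℕ} {s q : ℝ} (hs : 2 ≤ s) (hq : 2 ≤ q)
    [Fact (1 ≤ ENNReal.ofReal s)] (hm : m ≤ m₀)
    {X Y : Ω → PiLp (ENNReal.ofReal s) fun _ : Fin d => ℝ}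
    (hX : MemLp X (ENNReal.ofReal q) μ) (hY : MemLp Y (ENNReal.ofReal q) μ)
    (hXm : StronglyMeasurable[m] X) (hcond : ∀ i, μ[fun ω => Y ω i | m] =ᵐ[μ] 0) :
    lpNorm (X + Y) (ENNReal.ofReal q) μ ^ 2
      ≤ lpNorm X (ENNReal.ofReal q) μ ^ 2
        + (max q s - 1) * lpNorm Y (ENNReal.ofReal q) μ ^ 2 := by
  have hYi : Integrable Y μ := hY.integrable (ENNReal.one_le_ofReal.2 (by linarith))
  have hcond' : μ[Y | m] =ᵐ[μ] 0 := condExp_piLp_eq_zero hYi hcond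
  have hE (u v : PiLp (ENNReal.ofReal s) fun _ : Fin d => ℝ) :=
    norm_add_rpow_add_norm_sub_rpow_le_piLp hs (le_max_right q s) u v
  exact lpNorm_add_sq_le_of_condExp_eq_zero hq (le_max_left q s) hE hm hX hY hXm hcond'

lemma norm_toLp_eq_lnorm {s d : ℕ} (hs : 0 < s) (u : Fin d → ℝ) :
    ‖WithLp.toLp (ENNReal.ofReal (s : ℝ)) u‖ = lnorm s u := by
  have hs0 : (0 : ℝ) < s := by exact_mod_cast hs
  rw [lnorm, PiLp.norm_eq_sum (by rwa [ENNReal.toReal_ofReal hs0.le]),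
    ENNReal.toReal_ofReal hs0.le]
  simp

theorem stmt7 {Ω : Type*} [MeasurableSpace Ω] (μ : Measure Ω) [IsProbabilityMeasure μ]
    (d s : ℕ) (hs : 2 ≤ s) (hse : Even s) (q : ℝ) (hq : 2 ≤ q)
    (x y : Ω → Fin d → ℝ) (hx : Measurable x) (hy : Measurable y)
    (hxq : Integrable (fun ω => lnorm s (x ω) ^ q) μ)
    (hyq : Integrable (fun ω => lnorm s (y ω) ^ q) μ)
    (hcond : ∀ i, μ[(fun ω => y ω i) | MeasurableSpace.comap x inferInstance] =ᵐ[μ] 0) :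
    ((∫ ω, lnorm s (x ω + y ω) ^ q ∂μ) ^ (1 / q)) ^ 2
      ≤ ((∫ ω, lnorm s (x ω) ^ q ∂μ) ^ (1 / q)) ^ 2
        + (max q (s : ℝ) - 1) * ((∫ ω, lnorm s (y ω) ^ q ∂μ) ^ (1 / q)) ^ 2 := by
  have hs2 : (2 : ℝ) ≤ s := by exact_mod_cast hs
  have hq0 : 0 < q := by linarith
  have : Fact (1 ≤ ENNReal.ofReal (s : ℝ)) := ⟨ENNReal.one_le_ofReal.2 (by linarith)⟩
  have he : Continuous (WithLp.toLp (ENNReal.ofReal (s : ℝ)) : (Fin d → ℝ) → _) :=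
    PiLp.continuous_toLp _ _
  have hnorm := norm_toLp_eq_lnorm (d := d) (show 0 < s by lia)
  have hmem : ∀ z : Ω → Fin d → ℝ, Measurable z → Integrable (fun ω => lnorm s (z ω) ^ q) μ →
      MemLp (fun ω => WithLp.toLp (ENNReal.ofReal (s : ℝ)) (z ω)) (ENNReal.ofReal q) μ :=
    fun z hz hzq => by
      rw [← integrable_norm_rpow_iff (he.comp_stronglyMeasurable hz.stronglyMeasurable
        |>.aestronglyMeasurable) (ENNReal.ofReal_pos.2 hq0).ne' ENNReal.ofReal_ne_top]
      simpa only [hnorm, ENNReal.toReal_ofReal hq0.le] using hzq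
  have hX := hmem x hx hxq
  have hY := hmem y hy hyq
  have hxm : StronglyMeasurable[MeasurableSpace.comap x inferInstance]
      (fun ω => WithLp.toLp (ENNReal.ofReal (s : ℝ)) (x ω)) :=
    he.comp_stronglyMeasurable (comap_measurable x).stronglyMeasurable
  have key := lpNorm_add_sq_le_piLp hs2 hq hx.comap_le hX hY hxm hcond
  rw [lpNorm_ofReal_eq hq0 (hX.add hY).1, lpNorm_ofReal_eq hq0 hX.1,
    lpNorm_ofReal_eq hq0 hY.1] at key
  simpa only [Pi.add_apply, ← WithLp.toLp_add, hnorm] using key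
end

section
/- Suppose a function φ: [0,1] → R is twice differentiable with φ''(t) ≤ C for all t ∈ [0,1]. Then φ(1) ≤ φ(0) + φ'(0) + C/2. In particular, applying this to φ(t) = ‖|x + t y|_s‖_q² with C = 2(max{q,s}−1)‖|y|_s‖_q² yields ‖|x+y|_s‖_q² ≤ ‖|x|_s‖_q² + 2‖|x|_s‖_q^{2−q} E(|x|_s^{q−s} ∑_{j=1}^d x_j^{s−1} y_j) + (max{q,s}−1)‖|y|_s‖_q². -/
open Finset Real MeasureTheory

/-- Second-order Taylor bound on `[0, 1]`. -/
theorem le_add_deriv_add_half_of_deriv2_le (φ φ' φ'' : ℝ → ℝ) (C : ℝ)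
    (h₁ : ∀ t ∈ Set.Icc (0 : ℝ) 1, HasDerivAt φ (φ' t) t)
    (h₂ : ∀ t ∈ Set.Icc (0 : ℝ) 1, HasDerivAt φ' (φ'' t) t)
    (h₃ : ∀ t ∈ Set.Icc (0 : ℝ) 1, φ'' t ≤ C) :
    φ 1 ≤ φ 0 + φ' 0 + C / 2 := by
  have d₁ : ∀ t ∈ Set.Icc (0 : ℝ) 1, HasDerivAt (fun t => φ' t - C * t) (φ'' t - C) t := by
    intro t ht
    exact ((h₂ t ht).sub ((hasDerivAt_id t).const_mul C)).congr_deriv (by simp)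
  have a₁ : AntitoneOn (fun t => φ' t - C * t) (Set.Icc 0 1) := by
    refine antitoneOn_of_hasDerivWithinAt_nonpos (f' := fun t => φ'' t - C) (convex_Icc 0 1)
      (fun t ht => (d₁ t ht).continuousAt.continuousWithinAt)
      (fun t ht => (d₁ t (interior_subset ht)).hasDerivWithinAt) (fun t ht => ?_)
    linarith [h₃ t (interior_subset ht)]
  have d₂ : ∀ t ∈ Set.Icc (0 : ℝ) 1,
      HasDerivAt (fun t => φ t - φ' 0 * t - C / 2 * t ^ 2) (φ' t - φ' 0 - C * t) t := by
    intro t ht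
    refine (((h₁ t ht).sub ((hasDerivAt_id t).const_mul (φ' 0))).sub
      ((hasDerivAt_pow 2 t).const_mul (C / 2))).congr_deriv ?_
    norm_num
    ring
  have a₂ : AntitoneOn (fun t => φ t - φ' 0 * t - C / 2 * t ^ 2) (Set.Icc 0 1) := by
    refine antitoneOn_of_hasDerivWithinAt_nonpos (f' := fun t => φ' t - φ' 0 - C * t)
      (convex_Icc 0 1) (fun t ht => (d₂ t ht).continuousAt.continuousWithinAt)
      (fun t ht => (d₂ t (interior_subset ht)).hasDerivWithinAt) (fun t ht => ?_)
    have ht' := interior_subset ht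
    have := a₁ (Set.left_mem_Icc.2 zero_le_one) ht' ht'.1
    simp only at this
    linarith
  have := a₂ (Set.left_mem_Icc.2 zero_le_one) (Set.right_mem_Icc.2 zero_le_one) zero_le_one
  simp only at this
  linarith

theorem half_rpow_add_rpow_le {p q a b : ℝ} (ha : 0 ≤ a) (hb : 0 ≤ b) (hq : 0 ≤ q)
    (hp : 0 < p) (hqp : q ≤ p) :
    (a ^ q + b ^ q) / 2 ≤ ((a ^ p + b ^ p) / 2) ^ (q / p) := by
  have := (Real.concaveOn_rpow (p := q / p) (by positivity) ((div_le_one hp).2 hqp)).2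
    (Set.mem_Ici.2 (rpow_nonneg ha p)) (Set.mem_Ici.2 (rpow_nonneg hb p))
    (by norm_num : (0 : ℝ) ≤ 1 / 2) (by norm_num : (0 : ℝ) ≤ 1 / 2) (by norm_num)
  simp only [smul_eq_mul, ← rpow_mul ha, ← rpow_mul hb, mul_div_cancel₀ q hp.ne'] at this
  calc _ = 1 / 2 * a ^ q + 1 / 2 * b ^ q := by ring
    _ ≤ _ := this
    _ = _ := by congr 1; ring

theorem hasDerivAt_abs_rpow_mul_self {r : ℝ} (hr : 0 ≤ r) (x : ℝ) :
    HasDerivAt (fun x : ℝ => |x| ^ r * x) ((r + 1) * |x| ^ r) x := by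
  rcases hr.eq_or_lt with rfl | hr
  · simpa using hasDerivAt_id' x
  rcases eq_or_ne x 0 with rfl | hx
  · rw [hasDerivAt_iff_tendsto_slope]
    have h : Filter.Tendsto (fun x : ℝ => |x| ^ r) (nhdsWithin 0 {0}ᶜ)
        (nhds ((r + 1) * |0| ^ r)) := by
      have : Continuous fun x : ℝ => |x| ^ r := continuous_abs.rpow_const fun _ => Or.inr hr.le
      have := this.tendsto 0
      simp only [abs_zero, zero_rpow hr.ne', mul_zero] at this ⊢
      exact this.mono_left nhdsWithin_le_nhds
    refine h.congr' ?_
    filter_upwards [self_mem_nhdsWithin] with x hx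
    have hx : x ≠ 0 := hx
    simp [slope_def_field, hx]
  · refine (((hasDerivAt_abs hx).rpow_const (p := r) (Or.inl (abs_ne_zero.2 hx))).mul
      (hasDerivAt_id x)).congr_deriv ?_
    have h : |x| ^ (r - 1) * |x| = |x| ^ r := by
      rw [← rpow_add_one (abs_ne_zero.2 hx), sub_add_cancel]
    have h' : (SignType.sign x : ℝ) * x = |x| := by
      rw [mul_comm]; exact self_mul_sign x
    simp only [id]
    linear_combination r * |x| ^ (r - 1) * h' + r * h

/-- The sharp two-point inequality for the `L^p` norm. -/
theorem half_abs_add_rpow_add_abs_sub_rpow_le {p : ℝ} (hp : 2 ≤ p) (a b : ℝ) :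
    (|a + b| ^ p + |a - b| ^ p) / 2 ≤ (a ^ 2 + (p - 1) * b ^ 2) ^ (p / 2) := by
  have hp0 : 0 < p := by linarith
  rcases eq_or_ne a 0 with rfl | ha
  · have h : |b| ^ p = (b ^ 2) ^ (p / 2) := by
      rw [← sq_abs, ← rpow_natCast, ← rpow_mul (abs_nonneg b)]
      congr 1; push_cast; ring
    simp only [zero_add, zero_sub, abs_neg, add_self_div_two, h]
    refine rpow_le_rpow (sq_nonneg b) ?_ (by positivity)
    nlinarith [sq_nonneg b]
  set N : ℝ → ℝ := fun t => (|a + t * b| ^ p + |a - t * b| ^ p) / 2 with hN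
  set N' : ℝ → ℝ := fun t =>
    p * b / 2 * (|a + t * b| ^ (p - 2) * (a + t * b) - |a - t * b| ^ (p - 2) * (a - t * b)) with hN'
  set N'' : ℝ → ℝ := fun t =>
    p * (p - 1) * b ^ 2 * ((|a + t * b| ^ (p - 2) + |a - t * b| ^ (p - 2)) / 2) with hN''
  have du : ∀ t, HasDerivAt (fun t => a + t * b) b t := fun t => by
    simpa using ((hasDerivAt_id t).mul_const b).const_add a
  have dv : ∀ t, HasDerivAt (fun t => a - t * b) (-b) t := fun t => by
    simpa using ((hasDerivAt_id t).mul_const b).const_sub a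
  have dN : ∀ t, HasDerivAt N (N' t) t := fun t => by
    refine ((((hasDerivAt_abs_rpow (a + t * b) (by linarith : 1 < p)).comp t (du t)).add
      ((hasDerivAt_abs_rpow (a - t * b) (by linarith : 1 < p)).comp t (dv t))).div_const
        2).congr_deriv ?_
    simp only [hN']; ring
  have dN' : ∀ t, HasDerivAt N' (N'' t) t := fun t => by
    refine ((((hasDerivAt_abs_rpow_mul_self (by linarith : 0 ≤ p - 2) (a + t * b)).comp t
      (du t)).sub ((hasDerivAt_abs_rpow_mul_self (by linarith : 0 ≤ p - 2)
        (a - t * b)).comp t (dv t))).const_mul (p * b / 2)).congr_deriv ?_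
    simp only [hN'']; ring
  have Npos : ∀ t, 0 < N t := fun t => by
    have h1 : 0 ≤ |a + t * b| ^ p := by positivity
    have h2 : 0 ≤ |a - t * b| ^ p := by positivity
    by_contra! h
    simp only [hN] at h
    have h1' : |a + t * b| ^ p = 0 := by linarith
    have h2' : |a - t * b| ^ p = 0 := by linarith
    rw [rpow_eq_zero (abs_nonneg _) hp0.ne', abs_eq_zero] at h1' h2'
    exact ha (by linarith)
  have key := le_add_deriv_add_half_of_deriv2_le (fun t => N t ^ (2 / p))
    (fun t => N' t * (2 / p) * N t ^ (2 / p - 1))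
    (fun t => N'' t * (2 / p) * N t ^ (2 / p - 1) +
      N' t * (2 / p) * (N' t * (2 / p - 1) * N t ^ (2 / p - 1 - 1)))
    (2 * (p - 1) * b ^ 2)
    (fun t _ => (dN t).rpow_const (Or.inl (Npos t).ne'))
    (fun t _ => ((dN' t).mul_const (2 / p)).mul
      ((dN t).rpow_const (Or.inl (Npos t).ne'))) (fun t _ => by
    have hM := half_rpow_add_rpow_le (abs_nonneg (a + t * b)) (abs_nonneg (a - t * b))
      (by linarith : 0 ≤ p - 2) hp0 (by linarith)
    have h2 : 2 / p - 1 ≤ 0 := by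
      rw [sub_nonpos, div_le_one hp0]; exact hp
    have t2 : N' t * (2 / p) * (N' t * (2 / p - 1) * N t ^ (2 / p - 1 - 1)) ≤ 0 := by
      have : 0 ≤ (N' t) ^ 2 * (2 / p) * N t ^ (2 / p - 1 - 1) :=
        mul_nonneg (by positivity) (rpow_nonneg (Npos t).le _)
      nlinarith
    have hmul : N t ^ ((p - 2) / p) * N t ^ (2 / p - 1) = 1 := by
      rw [← rpow_add (Npos t)]
      convert rpow_zero (N t) using 2
      field_simp; ring
    have hc : 0 ≤ 2 * (p - 1) * b ^ 2 * N t ^ (2 / p - 1) :=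
      mul_nonneg (mul_nonneg (by linarith) (sq_nonneg b)) (rpow_nonneg (Npos t).le _)
    have t1 : N'' t * (2 / p) * N t ^ (2 / p - 1) ≤ 2 * (p - 1) * b ^ 2 := by
      calc N'' t * (2 / p) * N t ^ (2 / p - 1)
          = 2 * (p - 1) * b ^ 2 * N t ^ (2 / p - 1)
            * ((|a + t * b| ^ (p - 2) + |a - t * b| ^ (p - 2)) / 2) := by
              simp only [hN'']; field_simp
        _ ≤ 2 * (p - 1) * b ^ 2 * N t ^ (2 / p - 1) * N t ^ ((p - 2) / p) :=
              mul_le_mul_of_nonneg_left hM hc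
        _ = _ := by linear_combination 2 * (p - 1) * b ^ 2 * hmul
    linarith)
  have hN0 : N 0 ^ (2 / p) = a ^ 2 := by
    simp only [hN, zero_mul, add_zero, sub_zero, add_self_div_two]
    rw [← rpow_mul (abs_nonneg a), mul_div_cancel₀ _ hp0.ne', rpow_two, sq_abs]
  have hN'0 : N' 0 = 0 := by simp [hN']
  have hN1 : N 1 = (|a + b| ^ p + |a - b| ^ p) / 2 := by simp [hN]
  simp only [hN0, hN'0, zero_mul, add_zero] at key
  rw [← hN1]
  calc N 1 = (N 1 ^ (2 / p)) ^ (p / 2) := by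
        rw [← rpow_mul (Npos 1).le, div_mul_div_cancel₀ hp0.ne', div_self two_ne_zero, rpow_one]
    _ ≤ _ := rpow_le_rpow (rpow_nonneg (Npos 1).le _) (by linarith) (by positivity)

theorem rpow_sum_add_rpow_sum_le {ι : Type*} (t : Finset ι) {r : ℝ} (hr : 1 ≤ r) (a b : ι → ℝ)
    (ha : ∀ i, 0 ≤ a i) (hb : ∀ i, 0 ≤ b i) :
    ((∑ i ∈ t, a i) ^ r + (∑ i ∈ t, b i) ^ r) ^ (1 / r) ≤
      ∑ i ∈ t, (a i ^ r + b i ^ r) ^ (1 / r) := by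
  classical
  have hr0 : r ≠ 0 := by linarith
  induction t using Finset.induction_on with
  | empty => simp [hr0]
  | insert i t hi ih =>
    simp only [sum_insert hi]
    have h := Real.Lp_add_le_of_nonneg (s := Finset.univ) (f := ![a i, b i])
      (g := ![∑ j ∈ t, a j, ∑ j ∈ t, b j]) hr
      (by simp [Fin.forall_fin_two, ha, hb])
      (by simp [Fin.forall_fin_two, sum_nonneg, ha, hb])
    simp only [Fin.sum_univ_two, Matrix.cons_val_zero, Matrix.cons_val_one] at h
    linarith

theorem lnorm_nonneg (s : ℕ) {d : ℕ} (x : Fin d → ℝ) : 0 ≤ lnorm s x :=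
  rpow_nonneg (sum_nonneg fun _ _ => by positivity) _

theorem lnorm_rpow (s : ℕ) {d : ℕ} (x : Fin d → ℝ) (r : ℝ) :
    lnorm s x ^ r = (∑ i, |x i| ^ s) ^ (r / s) := by
  rw [lnorm, ← rpow_mul (sum_nonneg fun _ _ => by positivity), one_div_mul_eq_div]

theorem lnorm_pow {s : ℕ} (hs : s ≠ 0) {d : ℕ} (x : Fin d → ℝ) :
    lnorm s x ^ s = ∑ i, |x i| ^ s := by
  rw [← rpow_natCast, lnorm_rpow, div_self (by exact_mod_cast hs), rpow_one]

theorem lnorm_smul {s : ℕ} (hs : s ≠ 0) {d : ℕ} (t : ℝ) (x : Fin d → ℝ) :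
    lnorm s (t • x) = |t| * lnorm s x := by
  simp only [lnorm, Pi.smul_apply, smul_eq_mul, abs_mul, mul_pow, ← mul_sum]
  rw [mul_rpow (by positivity) (sum_nonneg fun _ _ => by positivity), one_div,
    pow_rpow_inv_natCast (abs_nonneg t) hs]

theorem measurable_lnorm (s d : ℕ) : Measurable (lnorm s : (Fin d → ℝ) → ℝ) := by
  unfold lnorm
  have : Measurable fun x : Fin d → ℝ => ∑ i, |x i| ^ s :=
    (continuous_finsetSum _ fun i _ => ((continuous_apply i).abs.pow s)).measurable
  exact this.pow_const _

/-- Hölder's inequality for the duality pairing `∑ xᵢ ^ (s - 1) yᵢ`. -/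
theorem sum_pow_mul_le_lnorm {s : ℕ} (hs : 2 ≤ s) {d : ℕ} (x y : Fin d → ℝ) :
    ∑ j, x j ^ (s - 1) * y j ≤ lnorm s x ^ (s - 1) * lnorm s y := by
  have hs1 : (1 : ℝ) < s := by exact_mod_cast hs
  have hc : ((s - 1 : ℕ) : ℝ) = s - 1 := by
    rw [Nat.cast_sub (by omega), Nat.cast_one]
  have hpq : ((s : ℝ) / (s - 1)).HolderConjugate s :=
    (Real.HolderConjugate.conjExponent hs1).symm
  have h := Real.inner_le_Lp_mul_Lq Finset.univ (fun j => x j ^ (s - 1)) y hpq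
  refine h.trans_eq ?_
  rw [← rpow_natCast (lnorm s x), lnorm_rpow, lnorm, hc]
  simp only [rpow_natCast]
  congr 2
  · refine sum_congr rfl fun j _ => ?_
    rw [abs_pow, ← rpow_natCast, ← rpow_mul (abs_nonneg _), hc, ← rpow_natCast]
    congr 1
    have : (s : ℝ) - 1 ≠ 0 := by linarith
    field_simp
  · rw [one_div_div]

theorem half_lnorm_add_rpow_add_lnorm_sub_rpow_le_of_le {s : ℕ} (hs : 2 ≤ s) {p : ℝ} (hp : s ≤ p)
    {d : ℕ} (x y : Fin d → ℝ) :
    (lnorm s (x + y) ^ p + lnorm s (x - y) ^ p) / 2 ≤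
      (lnorm s x ^ 2 + (p - 1) * lnorm s y ^ 2) ^ (p / 2) := by
  have hs2 : (2 : ℝ) ≤ s := by exact_mod_cast hs
  have hs0 : (0 : ℝ) < s := by linarith
  have hp2 : 2 ≤ p := by linarith
  have hp0 : 0 < p := by linarith
  have hr : 1 ≤ p / s := (one_le_div hs0).2 hp
  have hr0 : 0 < p / s := by positivity
  set c : Fin d → ℝ := fun j => x j ^ 2 + (p - 1) * y j ^ 2
  have hc0 : ∀ j, 0 ≤ c j := fun j => by
    have : 0 ≤ (p - 1) * y j ^ 2 := mul_nonneg (by linarith) (sq_nonneg _)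
    positivity
  have hpow : ∀ u : ℝ, (|u| ^ s) ^ (p / s) = |u| ^ p := fun u => by
    rw [← rpow_natCast, ← rpow_mul (abs_nonneg u), mul_div_cancel₀ _ hs0.ne']
  have hsq : ∀ u : ℝ, (u ^ 2) ^ ((s : ℝ) / 2) = |u| ^ s := fun u => by
    rw [← sq_abs, ← rpow_natCast, ← rpow_mul (abs_nonneg u), ← rpow_natCast]
    congr 1; push_cast; ring
  have hlsq : ∀ u : Fin d → ℝ, (∑ j, |u j| ^ s) ^ (1 / ((s : ℝ) / 2)) = lnorm s u ^ 2 := fun u => by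
    rw [← rpow_natCast (lnorm s u), lnorm_rpow, one_div_div]; norm_num
  have h1 := rpow_sum_add_rpow_sum_le Finset.univ hr (fun j => |(x + y) j| ^ s)
    (fun j => |(x - y) j| ^ s) (fun j => by positivity) (fun j => by positivity)
  have h2 : ∀ j, ((|(x + y) j| ^ s) ^ (p / s) + (|(x - y) j| ^ s) ^ (p / s)) ^ (1 / (p / s)) ≤
      2 ^ (1 / (p / s)) * c j ^ ((s : ℝ) / 2) := fun j => by
    have h := half_abs_add_rpow_add_abs_sub_rpow_le hp2 (x j) (y j)
    rw [hpow, hpow]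
    calc (|(x + y) j| ^ p + |(x - y) j| ^ p) ^ (1 / (p / s))
        ≤ (2 * c j ^ (p / 2)) ^ (1 / (p / s)) :=
          rpow_le_rpow (by positivity) (by simp only [Pi.add_apply, Pi.sub_apply]; linarith)
            (by positivity)
      _ = _ := by
          rw [mul_rpow zero_le_two (rpow_nonneg (hc0 j) _), ← rpow_mul (hc0 j)]
          congr 2; field_simp
  have h3 : (∑ j, c j ^ ((s : ℝ) / 2)) ^ (1 / ((s : ℝ) / 2)) ≤
      lnorm s x ^ 2 + (p - 1) * lnorm s y ^ 2 := by
    have h := Real.Lp_add_le_of_nonneg (s := Finset.univ) (f := fun j => x j ^ 2)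
      (g := fun j => (p - 1) * y j ^ 2) (p := (s : ℝ) / 2) (by linarith)
      (fun j _ => sq_nonneg _) (fun j _ => mul_nonneg (by linarith) (sq_nonneg _))
    refine h.trans_eq ?_
    have hp1 : 0 ≤ p - 1 := by linarith
    simp only [hsq, hlsq, mul_rpow hp1 (sq_nonneg _), ← mul_sum]
    rw [mul_rpow (rpow_nonneg hp1 _) (sum_nonneg fun _ _ => by positivity), hlsq,
      ← rpow_mul hp1, mul_one_div_cancel (by positivity), rpow_one]
  have hC : 0 ≤ ∑ j, c j ^ ((s : ℝ) / 2) := sum_nonneg fun j _ => rpow_nonneg (hc0 j) _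
  have h4 := h1.trans (sum_le_sum fun j _ => h2 j)
  rw [← mul_sum, ← lnorm_rpow, ← lnorm_rpow] at h4
  have hS : 0 ≤ lnorm s (x + y) ^ p + lnorm s (x - y) ^ p :=
    add_nonneg (rpow_nonneg (lnorm_nonneg _ _) _) (rpow_nonneg (lnorm_nonneg _ _) _)
  have h5 : lnorm s (x + y) ^ p + lnorm s (x - y) ^ p ≤
      2 * (∑ j, c j ^ ((s : ℝ) / 2)) ^ (p / s) := by
    have h := rpow_le_rpow (rpow_nonneg hS _) h4 hr0.le
    rwa [mul_rpow (by positivity) hC, ← rpow_mul hS, ← rpow_mul zero_le_two,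
      one_div_mul_cancel hr0.ne', rpow_one, rpow_one] at h
  have h6 : (∑ j, c j ^ ((s : ℝ) / 2)) ^ (p / s) ≤
      (lnorm s x ^ 2 + (p - 1) * lnorm s y ^ 2) ^ (p / 2) := by
    have h := rpow_le_rpow (rpow_nonneg hC _) h3 (by positivity : 0 ≤ p / 2)
    rw [← rpow_mul hC] at h
    convert h using 2
    field_simp
  linarith

theorem half_lnorm_add_rpow_add_lnorm_sub_rpow_le {s : ℕ} (hs : 2 ≤ s) {q : ℝ} (hq : 0 ≤ q)
    {d : ℕ} (x y : Fin d → ℝ) :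
    (lnorm s (x + y) ^ q + lnorm s (x - y) ^ q) / 2 ≤
      (lnorm s x ^ 2 + (max q s - 1) * lnorm s y ^ 2) ^ (q / 2) := by
  have hs2 : (2 : ℝ) ≤ s := by exact_mod_cast hs
  have hp : (s : ℝ) ≤ max q s := le_max_right _ _
  have hp0 : 0 < max q (s : ℝ) := by linarith
  have hn : 0 ≤ lnorm s x ^ 2 + (max q (s : ℝ) - 1) * lnorm s y ^ 2 :=
    add_nonneg (sq_nonneg _) (mul_nonneg (by linarith) (sq_nonneg _))
  refine (half_rpow_add_rpow_le (lnorm_nonneg s (x + y)) (lnorm_nonneg s (x - y)) hq hp0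
    (le_max_left _ _)).trans ?_
  refine (rpow_le_rpow (by
    have := rpow_nonneg (lnorm_nonneg s (x + y)) (max q (s : ℝ))
    have := rpow_nonneg (lnorm_nonneg s (x - y)) (max q (s : ℝ))
    positivity) (half_lnorm_add_rpow_add_lnorm_sub_rpow_le_of_le hs hp x y)
    (by positivity)).trans_eq ?_
  rw [← rpow_mul hn]
  congr 1; field_simp

/-- Minkowski's inequality for real-valued integrals. -/
theorem integral_Lp_add_le_of_nonneg {Ω : Type*} [MeasurableSpace Ω] {μ : Measure Ω} {r : ℝ}
    (hr : 1 ≤ r) {f g : Ω → ℝ} (hf : Measurable f) (hg : Measurable g) (hf0 : ∀ ω, 0 ≤ f ω)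
    (hg0 : ∀ ω, 0 ≤ g ω) (hfr : Integrable (fun ω => f ω ^ r) μ)
    (hgr : Integrable (fun ω => g ω ^ r) μ) :
    Integrable (fun ω => (f ω + g ω) ^ r) μ ∧
      (∫ ω, (f ω + g ω) ^ r ∂μ) ^ (1 / r) ≤
        (∫ ω, f ω ^ r ∂μ) ^ (1 / r) + (∫ ω, g ω ^ r ∂μ) ^ (1 / r) := by
  have hr0 : 0 < r := by linarith
  have hp0 : ENNReal.ofReal r ≠ 0 := by simpa using hr0
  have hpt : ENNReal.ofReal r ≠ ⊤ := ENNReal.ofReal_ne_top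
  have hpr : (ENNReal.ofReal r).toReal = r := ENNReal.toReal_ofReal hr0.le
  have iff : ∀ h : Ω → ℝ, Measurable h → (∀ ω, 0 ≤ h ω) →
      (Integrable (fun ω => h ω ^ r) μ ↔ MemLp h (ENNReal.ofReal r) μ) := fun h hm h0 => by
    rw [← integrable_norm_rpow_iff hm.aestronglyMeasurable hp0 hpt, hpr]
    simp only [Real.norm_eq_abs, abs_of_nonneg (h0 _)]
  have eLp : ∀ h : Ω → ℝ, (∀ ω, 0 ≤ h ω) → MemLp h (ENNReal.ofReal r) μ →
      eLpNorm h (ENNReal.ofReal r) μ = ENNReal.ofReal ((∫ ω, h ω ^ r ∂μ) ^ (1 / r)) :=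
    fun h h0 hm => by
    rw [hm.eLpNorm_eq_integral_rpow_norm hp0 hpt, hpr, one_div]
    simp only [Real.norm_eq_abs, abs_of_nonneg (h0 _)]
  have mf := (iff f hf hf0).1 hfr
  have mg := (iff g hg hg0).1 hgr
  have mfg : MemLp (fun ω => f ω + g ω) (ENNReal.ofReal r) μ := mf.add mg
  have h0 : ∀ ω, 0 ≤ f ω + g ω := fun ω => add_nonneg (hf0 ω) (hg0 ω)
  refine ⟨(iff _ (hf.add hg) h0).2 mfg, ?_⟩
  have h : eLpNorm (fun ω => f ω + g ω) (ENNReal.ofReal r) μ ≤ _ :=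
    eLpNorm_add_le mf.1 mg.1 (by simpa using hr)
  have nn : ∀ h : Ω → ℝ, (∀ ω, 0 ≤ h ω) → 0 ≤ (∫ ω, h ω ^ r ∂μ) ^ (1 / r) := fun h h0 =>
    rpow_nonneg (integral_nonneg fun ω => rpow_nonneg (h0 ω) _) _
  rwa [eLp _ h0 mfg, eLp f hf0 mf, eLp g hg0 mg, ← ENNReal.ofReal_add (nn f hf0) (nn g hg0),
    ENNReal.ofReal_le_ofReal_iff (add_nonneg (nn f hf0) (nn g hg0))] at h

/-- A pointwise parallelogram-type bound lifts to `L^q` norms. -/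
theorem Lq_parallelogram_of_pointwise {Ω : Type*} [MeasurableSpace Ω] {μ : Measure Ω} {q K : ℝ}
    (hq : 2 ≤ q) (hK : 0 ≤ K) {f g A B : Ω → ℝ} (hf : Measurable f) (hg : Measurable g)
    (hA : Measurable A) (hB : Measurable B) (hf0 : ∀ ω, 0 ≤ f ω) (hg0 : ∀ ω, 0 ≤ g ω)
    (hA0 : ∀ ω, 0 ≤ A ω) (hB0 : ∀ ω, 0 ≤ B ω) (hfq : Integrable (fun ω => f ω ^ q) μ)
    (hgq : Integrable (fun ω => g ω ^ q) μ)
    (h : ∀ ω, (A ω ^ q + B ω ^ q) / 2 ≤ (f ω ^ 2 + K * g ω ^ 2) ^ (q / 2)) :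
    Integrable (fun ω => A ω ^ q) μ ∧
    ((∫ ω, A ω ^ q ∂μ) ^ (1 / q)) ^ 2 + ((∫ ω, B ω ^ q ∂μ) ^ (1 / q)) ^ 2 ≤
      2 * ((∫ ω, f ω ^ q ∂μ) ^ (1 / q)) ^ 2 + 2 * K * ((∫ ω, g ω ^ q ∂μ) ^ (1 / q)) ^ 2 := by
  have hq0 : 0 < q := by linarith
  have sq_half : ∀ u : ℝ, 0 ≤ u → (u ^ 2) ^ (q / 2) = u ^ q := fun u hu => by
    rw [← rpow_natCast, ← rpow_mul hu]; congr 1; push_cast; ring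
  have root : ∀ u : ℝ, 0 ≤ u → u ^ (1 / (q / 2)) = (u ^ (1 / q)) ^ 2 := fun u hu => by
    rw [← rpow_natCast, ← rpow_mul hu]; congr 1; push_cast; field_simp
  have int0 : ∀ u : Ω → ℝ, (∀ ω, 0 ≤ u ω) → 0 ≤ ∫ ω, u ω ^ q ∂μ := fun u hu =>
    integral_nonneg fun ω => rpow_nonneg (hu ω) _
  have hKg : ∀ ω, (K * g ω ^ 2) ^ (q / 2) = K ^ (q / 2) * g ω ^ q := fun ω => by
    rw [mul_rpow hK (sq_nonneg _), sq_half _ (hg0 ω)]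
  obtain ⟨hint, hle⟩ := integral_Lp_add_le_of_nonneg (μ := μ) (r := q / 2) (by linarith)
    (hf.pow_const 2) ((hg.pow_const 2).const_mul K) (fun ω => sq_nonneg (f ω))
    (fun ω => mul_nonneg hK (sq_nonneg (g ω)))
    (by simpa only [sq_half _ (hf0 _)] using hfq)
    (by simpa only [hKg] using hgq.const_mul _)
  have hdom : ∀ u v : Ω → ℝ, Measurable u → (∀ ω, 0 ≤ u ω) → (∀ ω, 0 ≤ v ω) →
      (∀ ω, (u ω ^ q + v ω ^ q) / 2 ≤ (f ω ^ 2 + K * g ω ^ 2) ^ (q / 2)) →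
      Integrable (fun ω => u ω ^ q) μ := fun u v hu hu0 hv0 huv => by
    refine (hint.const_mul 2).mono' (hu.pow_const q).aestronglyMeasurable
      (Filter.Eventually.of_forall fun ω => ?_)
    rw [Real.norm_eq_abs, abs_of_nonneg (rpow_nonneg (hu0 ω) q)]
    linarith [huv ω, rpow_nonneg (hv0 ω) q]
  have iA := hdom A B hA hA0 hB0 h
  have iB := hdom B A hB hB0 hA0 fun ω => by rw [add_comm]; exact h ω
  refine ⟨iA, ?_⟩
  have hAB : ((∫ ω, A ω ^ q ∂μ) + ∫ ω, B ω ^ q ∂μ) / 2 ≤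
      ∫ ω, (f ω ^ 2 + K * g ω ^ 2) ^ (q / 2) ∂μ := by
    rw [← integral_add iA iB, ← integral_div]
    exact integral_mono ((iA.add iB).div_const 2) hint h
  have hmean := half_rpow_add_rpow_le (p := q) (q := 2)
    (rpow_nonneg (int0 A hA0) (1 / q)) (rpow_nonneg (int0 B hB0) (1 / q)) zero_le_two hq0 hq
  rw [rpow_two, rpow_two, ← rpow_mul (int0 A hA0), ← rpow_mul (int0 B hB0),
    one_div_mul_cancel hq0.ne', rpow_one, rpow_one] at hmean
  have hroot := rpow_le_rpow (by linarith [int0 A hA0, int0 B hB0]) hAB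
    (by positivity : 0 ≤ 2 / q)
  rw [one_div_div] at hle
  simp only [hKg, sq_half _ (hf0 _), integral_const_mul] at hle
  rw [mul_rpow (rpow_nonneg hK _) (int0 g hg0), ← rpow_mul hK, ← one_div_div q 2,
    mul_one_div_cancel (by positivity), rpow_one, root _ (int0 f hf0), root _ (int0 g hg0),
    one_div_div] at hle
  linarith

/-- A function bounded below by an affine function touching it at `0` and with second differences
at most those of `c t ^ 2` satisfies the corresponding quadratic upper bound. -/
theorem le_of_second_difference_le {g : ℝ → ℝ} {m c : ℝ}
    (h₁ : ∀ t u, g (t + u) + g (t - u) ≤ 2 * g t + 2 * c * u ^ 2)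
    (h₂ : ∀ t, g 0 + m * t ≤ g t) : g 1 ≤ g 0 + m + c := by
  have step : ∀ (u : ℝ) (k : ℕ), g ((k + 1) * u) - g (k * u) ≤ m * u + 2 * c * u ^ 2 * (k + 1) ∧
      g (k * u) ≤ g 0 + m * (k * u) + c * u ^ 2 * (k * (k + 1)) := by
    intro u k
    induction k with
    | zero =>
      have a := h₁ 0 u
      have b := h₂ (-u)
      simp only [zero_add, zero_sub] at a
      constructor
      · simp only [Nat.cast_zero, zero_add, one_mul, zero_mul]
        linarith
      · simp
    | succ k ih =>
      have a := h₁ ((k + 1) * u) u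
      rw [show (k + 1) * u + u = (k + 1 + 1) * u by ring,
        show (k + 1) * u - u = k * u by ring] at a
      push_cast
      constructor
      · linarith [ih.1]
      · linarith [ih.1, ih.2]
  have bound : ∀ n : ℕ, g 1 ≤ g 0 + m + c + c * (1 / ((n : ℝ) + 1)) := fun n => by
    have hn : (n : ℝ) + 1 ≠ 0 := by positivity
    have h := (step (1 / ((n : ℝ) + 1)) (n + 1)).2
    push_cast at h
    rw [mul_one_div_cancel hn] at h
    refine h.trans_eq ?_
    field_simp
    ring
  refine ge_of_tendsto' (f := fun n : ℕ => g 0 + m + c + c * (1 / ((n : ℝ) + 1)))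
    (x := Filter.atTop) ?_ bound
  simpa using (tendsto_one_div_add_atTop_nhds_zero_nat (𝕜 := ℝ)).const_mul c |>.const_add
    (g 0 + m + c)

/-- The duality pairing with `x` gives a subgradient at `x` of half the squared `L^q(ℓ^s)` norm. -/
theorem Lq_lnorm_subgradient {Ω : Type*} [MeasurableSpace Ω] {μ : Measure Ω}
    {d s : ℕ} (hs : 2 ≤ s) (hse : Even s) {q : ℝ} (hq : 2 ≤ q) {x y : Ω → Fin d → ℝ}
    (hx : Measurable x) (hy : Measurable y)
    (hxq : Integrable (fun ω => lnorm s (x ω) ^ q) μ)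
    (hcross : Integrable
      (fun ω => lnorm s (x ω) ^ (q - (s : ℝ)) * ∑ j, x ω j ^ (s - 1) * y ω j) μ) (t : ℝ)
    (hz : Integrable (fun ω => lnorm s (x ω + t • y ω) ^ q) μ) :
    ((∫ ω, lnorm s (x ω) ^ q ∂μ) ^ (1 / q)) ^ 2
        + 2 * ((∫ ω, lnorm s (x ω) ^ q ∂μ) ^ (1 / q)) ^ (2 - q) *
            (∫ ω, lnorm s (x ω) ^ (q - (s : ℝ)) * ∑ j, x ω j ^ (s - 1) * y ω j ∂μ) * t ≤
      ((∫ ω, lnorm s (x ω + t • y ω) ^ q ∂μ) ^ (1 / q)) ^ 2 := by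
  have hq0 : 0 < q := by linarith
  have hs0 : s ≠ 0 := by omega
  set I := ∫ ω, lnorm s (x ω) ^ (q - (s : ℝ)) * ∑ j, x ω j ^ (s - 1) * y ω j ∂μ
  set J := ∫ ω, lnorm s (x ω) ^ q ∂μ
  set L := ∫ ω, lnorm s (x ω + t • y ω) ^ q ∂μ
  have hJ0 : 0 ≤ J := integral_nonneg fun ω => rpow_nonneg (lnorm_nonneg _ _) _
  have mx : Measurable fun ω => lnorm s (x ω) := (measurable_lnorm s d).comp hx
  have mz : Measurable fun ω => lnorm s (x ω + t • y ω) :=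
    (measurable_lnorm s d).comp (hx.add (hy.const_smul t))
  have hpq : (q / (q - 1)).HolderConjugate q :=
    (Real.HolderConjugate.conjExponent (by linarith : 1 < q)).symm
  have hxpow : ∀ ω, (lnorm s (x ω) ^ (q - 1)) ^ (q / (q - 1)) = lnorm s (x ω) ^ q := fun ω => by
    rw [← rpow_mul (lnorm_nonneg _ _), mul_div_cancel₀ _ (by linarith : q - 1 ≠ 0)]
  have memLp : ∀ (f : Ω → ℝ) (r : ℝ), 0 < r → Measurable f → (∀ ω, 0 ≤ f ω) →
      Integrable (fun ω => f ω ^ r) μ → MemLp f (ENNReal.ofReal r) μ := fun f r hr hm h0 hi => by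
    rw [← integrable_norm_rpow_iff hm.aestronglyMeasurable (by simpa using hr)
      ENNReal.ofReal_ne_top, ENNReal.toReal_ofReal hr.le]
    simpa only [Real.norm_eq_abs, abs_of_nonneg (h0 _)] using hi
  have m1 : MemLp (fun ω => lnorm s (x ω) ^ (q - 1)) (ENNReal.ofReal (q / (q - 1))) μ :=
    memLp _ _ hpq.pos (mx.pow_const _) (fun ω => rpow_nonneg (lnorm_nonneg _ _) _)
      (by simpa only [hxpow] using hxq)
  have m2 : MemLp (fun ω => lnorm s (x ω + t • y ω)) (ENNReal.ofReal q) μ :=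
    memLp _ _ hq0 mz (fun ω => lnorm_nonneg _ _) hz
  have holder := integral_mul_le_Lp_mul_Lq_of_nonneg hpq
    (Filter.Eventually.of_forall fun ω => rpow_nonneg (lnorm_nonneg s (x ω)) (q - 1))
    (Filter.Eventually.of_forall fun ω => lnorm_nonneg s (x ω + t • y ω)) m1 m2
  simp only [hxpow] at holder
  have : (ENNReal.ofReal (q / (q - 1))).HolderConjugate (ENNReal.ofReal q) :=
    hpq.ennrealOfReal
  have hprod : Integrable
      (fun ω => lnorm s (x ω) ^ (q - 1) * lnorm s (x ω + t • y ω)) μ := m1.integrable_mul m2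
  have hpt : ∀ ω, lnorm s (x ω) ^ q +
      t * (lnorm s (x ω) ^ (q - (s : ℝ)) * ∑ j, x ω j ^ (s - 1) * y ω j) ≤
      lnorm s (x ω) ^ (q - 1) * lnorm s (x ω + t • y ω) := fun ω => by
    have hn := lnorm_nonneg s (x ω)
    have e1 : lnorm s (x ω) ^ q = lnorm s (x ω) ^ (q - (s : ℝ)) * lnorm s (x ω) ^ s := by
      rcases hn.eq_or_lt with h | h
      · simp [← h, hq0.ne', hs0]
      · rw [← rpow_natCast, ← rpow_add h, sub_add_cancel]
    have e2 : lnorm s (x ω) ^ (q - (s : ℝ)) * lnorm s (x ω) ^ (s - 1) =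
        lnorm s (x ω) ^ (q - 1) := by
      rcases hn.eq_or_lt with h | h
      · rw [← h, zero_rpow (by linarith : q - 1 ≠ 0), zero_pow (by omega), mul_zero]
      · rw [← rpow_natCast, ← rpow_add h, Nat.cast_sub (by omega), Nat.cast_one]
        congr 1; ring
    have e3 : ∑ j, x ω j ^ (s - 1) * (x ω + t • y ω) j =
        lnorm s (x ω) ^ s + t * ∑ j, x ω j ^ (s - 1) * y ω j := by
      rw [lnorm_pow hs0, mul_sum, ← sum_add_distrib]
      refine sum_congr rfl fun j _ => ?_
      rw [hse.pow_abs, ← pow_sub_one_mul hs0 (x ω j)]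
      simp only [Pi.add_apply, Pi.smul_apply, smul_eq_mul]
      ring
    have hh := mul_le_mul_of_nonneg_left (sum_pow_mul_le_lnorm hs (x ω) (x ω + t • y ω))
      (rpow_nonneg hn (q - (s : ℝ)))
    rw [e3, ← mul_assoc, e2] at hh
    rw [e1]
    linarith
  have hint := integral_mono (hxq.add (hcross.const_mul t)) hprod hpt
  have hsum : J + t * I ≤ J ^ (1 / (q / (q - 1))) * L ^ (1 / q) := by
    refine le_trans (le_of_eq ?_) (hint.trans holder)
    simp only [Pi.add_apply]
    rw [integral_add hxq (hcross.const_mul t), integral_const_mul]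
  rcases hJ0.eq_or_lt with h | h
  · have hexp : 1 / (q / (q - 1)) ≠ 0 := (one_div_pos.2 hpq.pos).ne'
    have hI0 : t * I ≤ 0 := by
      rwa [← h, zero_rpow hexp, zero_mul, zero_add] at hsum
    have hn : 0 ≤ (J ^ (1 / q)) ^ (2 - q) := rpow_nonneg (rpow_nonneg hJ0 _) _
    have hJ1 : J ^ (1 / q) = 0 := by rw [← h, zero_rpow (by positivity)]
    have : (J ^ (1 / q)) ^ 2 = 0 := by rw [hJ1]; norm_num
    nlinarith [sq_nonneg (L ^ (1 / q))]
  · set a := J ^ (1 / q) with ha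
    have ha0 : 0 < a := rpow_pos_of_pos h _
    have c1 : a ^ (2 - q) * J = a ^ 2 := by
      have : J = a ^ q := by rw [ha, ← rpow_mul hJ0, one_div_mul_cancel hq0.ne', rpow_one]
      rw [this, ← rpow_add ha0, sub_add_cancel, rpow_two]
    have c2 : a ^ (2 - q) * J ^ (1 / (q / (q - 1))) = a := by
      have : J ^ (1 / (q / (q - 1))) = a ^ (q - 1) := by
        rw [ha, ← rpow_mul hJ0]; congr 1; field_simp
      rw [this, ← rpow_add ha0]
      convert rpow_one a using 2
      ring
    have hh := mul_le_mul_of_nonneg_left hsum (rpow_nonneg ha0.le (2 - q))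
    rw [mul_add, c1, ← mul_assoc (a ^ (2 - q)) (J ^ _), c2] at hh
    nlinarith [sq_nonneg (a - L ^ (1 / q))]

theorem stmt14 {Ω : Type*} [MeasurableSpace Ω] (μ : Measure Ω) [IsProbabilityMeasure μ]
    (d s : ℕ) (hs : 2 ≤ s) (hse : Even s) (q : ℝ) (hq : 2 ≤ q)
    (x y : Ω → Fin d → ℝ) (hx : Measurable x) (hy : Measurable y)
    (hxq : Integrable (fun ω => lnorm s (x ω) ^ q) μ)
    (hyq : Integrable (fun ω => lnorm s (y ω) ^ q) μ)
    (hcross : Integrable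
      (fun ω => lnorm s (x ω) ^ (q - (s : ℝ)) * ∑ j, x ω j ^ (s - 1) * y ω j) μ) :
    (∀ (φ φ' φ'' : ℝ → ℝ) (C : ℝ),
        (∀ t ∈ Set.Icc (0 : ℝ) 1, HasDerivAt φ (φ' t) t) →
        (∀ t ∈ Set.Icc (0 : ℝ) 1, HasDerivAt φ' (φ'' t) t) →
        (∀ t ∈ Set.Icc (0 : ℝ) 1, φ'' t ≤ C) →
        φ 1 ≤ φ 0 + φ' 0 + C / 2) ∧
    ((∫ ω, lnorm s (x ω + y ω) ^ q ∂μ) ^ (1 / q)) ^ 2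
      ≤ ((∫ ω, lnorm s (x ω) ^ q ∂μ) ^ (1 / q)) ^ 2
        + 2 * ((∫ ω, lnorm s (x ω) ^ q ∂μ) ^ (1 / q)) ^ (2 - q) *
            (∫ ω, lnorm s (x ω) ^ (q - (s : ℝ)) * ∑ j, x ω j ^ (s - 1) * y ω j ∂μ)
        + (max q (s : ℝ) - 1) * ((∫ ω, lnorm s (y ω) ^ q ∂μ) ^ (1 / q)) ^ 2 := by
  refine ⟨le_add_deriv_add_half_of_deriv2_le, ?_⟩
  have hq0 : 0 < q := by linarith
  have hK : 0 ≤ max q (s : ℝ) - 1 := by linarith [le_max_left q (s : ℝ)]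
  have ml : ∀ z : Ω → Fin d → ℝ, Measurable z → Measurable fun ω => lnorm s (z ω) :=
    fun z hz => (measurable_lnorm s d).comp hz
  have nl : ∀ (z : Ω → Fin d → ℝ) (ω : Ω), 0 ≤ lnorm s (z ω) := fun z ω => lnorm_nonneg s (z ω)
  have smul_rpow : ∀ (u : ℝ) (ω : Ω),
      lnorm s (u • y ω) ^ q = |u| ^ q * lnorm s (y ω) ^ q := fun u ω => by
    rw [lnorm_smul (by omega), mul_rpow (abs_nonneg u) (lnorm_nonneg _ _)]
  have iu : ∀ u : ℝ, Integrable (fun ω => lnorm s (u • y ω) ^ q) μ := fun u => by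
    simpa only [smul_rpow] using hyq.const_mul (|u| ^ q)
  have nu : ∀ u : ℝ, ((∫ ω, lnorm s (u • y ω) ^ q ∂μ) ^ (1 / q)) ^ 2 =
      u ^ 2 * ((∫ ω, lnorm s (y ω) ^ q ∂μ) ^ (1 / q)) ^ 2 := fun u => by
    simp only [smul_rpow, integral_const_mul]
    rw [mul_rpow (by positivity) (integral_nonneg fun ω => rpow_nonneg (nl y ω) q),
      ← rpow_mul (abs_nonneg u), mul_one_div_cancel hq0.ne', rpow_one, mul_pow, sq_abs]
  have par := fun (z : Ω → Fin d → ℝ) (hz : Measurable z)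
      (hzq : Integrable (fun ω => lnorm s (z ω) ^ q) μ) (u : ℝ) =>
    Lq_parallelogram_of_pointwise hq hK (ml z hz) (ml _ (hy.const_smul u))
      (ml _ (hz.add (hy.const_smul u))) (ml _ (hz.sub (hy.const_smul u))) (nl z) (nl _) (nl _)
      (nl _) hzq (iu u) fun ω => half_lnorm_add_rpow_add_lnorm_sub_rpow_le hs hq0.le (z ω) (u • y ω)
  have iz : ∀ t : ℝ, Integrable (fun ω => lnorm s (x ω + t • y ω) ^ q) μ := fun t =>
    (par x hx hxq t).1
  have main := le_of_second_difference_le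
    (g := fun t => ((∫ ω, lnorm s (x ω + t • y ω) ^ q ∂μ) ^ (1 / q)) ^ 2)
    (m := 2 * ((∫ ω, lnorm s (x ω) ^ q ∂μ) ^ (1 / q)) ^ (2 - q) *
      ∫ ω, lnorm s (x ω) ^ (q - (s : ℝ)) * ∑ j, x ω j ^ (s - 1) * y ω j ∂μ)
    (c := (max q (s : ℝ) - 1) * ((∫ ω, lnorm s (y ω) ^ q ∂μ) ^ (1 / q)) ^ 2)
    (fun t u => by
      have h := (par (fun ω => x ω + t • y ω) (hx.add (hy.const_smul t)) (iz t) u).2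
      simp only [Pi.add_apply, Pi.sub_apply, Pi.smul_apply, add_assoc, add_sub_assoc, ← add_smul,
        ← sub_smul, nu] at h
      linarith)
    (fun t => by
      simpa using Lq_lnorm_subgradient hs hse hq hx hy hxq hcross t (iz t))
  simpa using main
end
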